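/- Let y be a nonnegative integer and suppose p = 4y^2 + 5y + 2 is a prime with p ≥ 5. Then there does not exist a nontrivial regular (8p^3, 4p^2−2p+4y+2, 2p+8y+2, 2p−2)-partial difference set in any Abelian group of order 8p^3. -/

import Mathlib

variable {G : Type*} [CommGroup G] [DecidableEq G] [Fintype G]

/-- The number of representations of `g` as `d₁ * d₂⁻¹` with `d₁, d₂ ∈ D`, `d₁ ≠ d₂`. -/
def pdsReps (D : Finset G) (g : G) : ℕ :=
  ((D ×ˢ D).filter (fun x => x.1 ≠ x.2 ∧ x.1 * x.2⁻¹ = g)).card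

/-- `D` is a `(v,k,λ,μ)`-partial difference set in `G`. -/
def IsPDS (D : Finset G) (v k l m : ℕ) : Prop :=
  Fintype.card G = v ∧ D.card = k ∧
  (∀ g : G, g ≠ 1 → g ∈ D → pdsReps D g = l) ∧
  (∀ g : G, g ≠ 1 → g ∉ D → pdsReps D g = m)

/-- `D` is regular: closed under inverses and not containing the identity. -/
def IsRegularPDS (D : Finset G) : Prop :=
  (∀ d ∈ D, d⁻¹ ∈ D) ∧ (1 : G) ∉ D

/-- A regular PDS is trivial if `D ∪ {e}` or `G \ D` is a subgroup. -/
def IsTrivialPDS (D : Finset G) : Prop :=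
  (∃ H : Subgroup G, (H : Set G) = ↑D ∪ {1}) ∨
  (∃ H : Subgroup G, (H : Set G) = (↑D : Set G)ᶜ)

open MonoidAlgebra in
theorem coeff_sum_single_one {R : Type*} [Semiring R] {M : Type*} [DecidableEq M]
    {ι : Type*} (s : Finset ι) (f : ι → M) (g : M) :
    (∑ i ∈ s, single (f i) (1 : R)).coeff g = ((s.filter (fun i => f i = g)).card : R) := by
  simp [coeff_sum, Finsupp.finsetSum_apply, Finsupp.single_apply]

theorem exists_pow_succ_eq_add_smul {F A : Type*} [Field F] [CommRing A] [Algebra F A]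
    {Y J : A} {c m n : F} (hY : Y ^ 2 = c • Y + m • J) (hJ : Y * J = n • J) (i : ℕ) :
    ∃ u : F, Y ^ (i + 1) = c ^ i • Y + u • J := by
  induction i with
  | zero => exact ⟨0, by simp⟩
  | succ i ih =>
    obtain ⟨u, hu⟩ := ih
    refine ⟨c ^ i * m + u * n, ?_⟩
    calc Y ^ (i + 1 + 1) = c ^ i • Y ^ 2 + u • (Y * J) := by
          rw [pow_succ, hu, add_mul, smul_mul_assoc, smul_mul_assoc, mul_comm J, sq]
      _ = _ := by rw [hY, hJ]; module

section GroupAlgebra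

open MonoidAlgebra

theorem card_filter_mul_eq_of_isPDS {G : Type*} [CommGroup G] [DecidableEq G] [Fintype G]
    {D : Finset G} {v k l m : ℕ} (hD : IsPDS D v k l m) (hr : IsRegularPDS D) (g : G) :
    ((D ×ˢ D).filter (fun x => x.1 * x.2 = g)).card =
      if g = 1 then k else if g ∈ D then l else m := by
  have hinv : ((D ×ˢ D).filter (fun x => x.1 * x.2 = g)).card =
      ((D ×ˢ D).filter (fun x => x.1 * x.2⁻¹ = g)).card := by
    refine Finset.card_bij' (fun x _ => (x.1, x.2⁻¹)) (fun x _ => (x.1, x.2⁻¹)) ?_ ?_ ?_ ?_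
    · intro x hx
      simp only [Finset.mem_filter, Finset.mem_product] at hx ⊢
      exact ⟨⟨hx.1.1, hr.1 _ hx.1.2⟩, by simpa using hx.2⟩
    · intro x hx
      simp only [Finset.mem_filter, Finset.mem_product] at hx ⊢
      exact ⟨⟨hx.1.1, hr.1 _ hx.1.2⟩, by simpa using hx.2⟩
    · simp
    · simp
  rw [hinv]
  split_ifs with h1 h2
  · subst h1
    rw [← hD.2.1]
    refine Finset.card_bij' (fun x _ => x.1) (fun x _ => (x, x)) ?_ ?_ ?_ ?_
    · intro x hx
      simp only [Finset.mem_filter, Finset.mem_product] at hx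
      exact hx.1.1
    · intro x hx
      simpa using hx
    · intro x hx
      simp only [Finset.mem_filter, mul_inv_eq_one] at hx
      exact Prod.ext rfl hx.2
    · simp
  all_goals
    have hfil : ((D ×ˢ D).filter (fun x => x.1 * x.2⁻¹ = g)) =
        ((D ×ˢ D).filter (fun x => x.1 ≠ x.2 ∧ x.1 * x.2⁻¹ = g)) := by
      refine Finset.filter_congr fun x _ => ⟨fun h => ⟨fun h' => h1 ?_, h⟩, fun h => h.2⟩
      rw [← h, h', mul_inv_cancel]
    rw [hfil]
  · exact hD.2.2.1 g h1 h2
  · exact hD.2.2.2 g h1 h2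

/-- A regular partial difference set with integer eigenvalues `a` and `b` is closed under
`x ↦ x ^ q` for every prime `q` dividing neither the group order nor `a - b`. -/
theorem pow_prime_mem_of_isPDS {G : Type*} [CommGroup G] [DecidableEq G] [Fintype G]
    {D : Finset G} {v k l m : ℕ} (hD : IsPDS D v k l m) (hr : IsRegularPDS D)
    {a b : ℤ} (hsum : a + b = l - m) (hmul : a * b = m - k)
    {q : ℕ} (hq : q.Prime) (hqv : ¬ q ∣ v) (hqab : ¬ (q : ℤ) ∣ a - b)
    {d : G} (hd : d ∈ D) : d ^ q ∈ D := by
  have : Fact q.Prime := ⟨hq⟩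
  have : CharP (MonoidAlgebra (ZMod q) G) q :=
    charP_of_injective_algebraMap (algebraMap (ZMod q) (MonoidAlgebra (ZMod q) G)).injective q
  obtain ⟨X, hX⟩ : ∃ X : MonoidAlgebra (ZMod q) G, X = ∑ x ∈ D, single x 1 := ⟨_, rfl⟩
  obtain ⟨J, hJ⟩ : ∃ J : MonoidAlgebra (ZMod q) G, J = ∑ x : G, single x 1 := ⟨_, rfl⟩
  have hXc (g : G) : X.coeff g = if g ∈ D then 1 else 0 := by
    rw [hX, coeff_sum_single_one, Finset.filter_eq']
    split_ifs <;> simp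
  have hJc (g : G) : J.coeff g = 1 := by
    rw [hJ, coeff_sum_single_one, Finset.filter_eq']
    simp
  have hsJ (x : G) : single x 1 * J = J := by
    simp only [hJ, Finset.mul_sum, single_mul_single, one_mul]
    exact Fintype.sum_equiv (Equiv.mulLeft x) _ _ fun _ => rfl
  have hXJ : X * J = (k : ZMod q) • J := by
    rw [hX]
    simp only [Finset.sum_mul, hsJ, Finset.sum_const, hD.2.1, Nat.cast_smul_eq_nsmul]
  have hJJ : J * J = (v : ZMod q) • J := by
    nth_rw 1 [hJ]
    simp only [Finset.sum_mul, hsJ, Finset.sum_const, Finset.card_univ, hD.1,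
      Nat.cast_smul_eq_nsmul]
  have hsumF : (a : ZMod q) + b = l - m := by
    simpa using congrArg (Int.cast : ℤ → ZMod q) hsum
  have hmulF : (a : ZMod q) * b = m - k := by
    simpa using congrArg (Int.cast : ℤ → ZMod q) hmul
  have hXX : X * X = ((a : ZMod q) + b) • X - ((a : ZMod q) * b) • 1 + (m : ZMod q) • J := by
    have hXX' : X * X = ∑ x ∈ D ×ˢ D, single (x.1 * x.2) 1 := by
      simp only [hX, Finset.sum_mul_sum, Finset.sum_product, single_mul_single, one_mul]
    apply coeff_injective
    ext g
    rw [hXX', coeff_sum_single_one, card_filter_mul_eq_of_isPDS hD hr]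
    simp only [coeff_add, coeff_sub, coeff_smul, Finsupp.add_apply, Finsupp.sub_apply,
      Finsupp.smul_apply, hXc, hJc, hsumF, hmulF, one_def, coeff_single, Finsupp.single_apply,
      smul_eq_mul, eq_comm (a := (1 : G))]
    by_cases h1 : g = 1
    · simp [h1, hr.2]
    · by_cases h2 : g ∈ D <;> simp [h1, h2]
  obtain ⟨Y, hY⟩ : ∃ Y : MonoidAlgebra (ZMod q) G, Y = X - algebraMap (ZMod q) _ b :=
    ⟨_, rfl⟩
  have hYY : Y ^ 2 = ((a : ZMod q) - b) • Y + (m : ZMod q) • J := by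
    have : Y ^ 2 = X * X - (2 * (b : ZMod q)) • X + ((b : ZMod q) * b) • 1 := by
      simp only [hY, Algebra.smul_def, map_mul, map_ofNat]
      ring
    rw [this, hXX]
    simp only [hY, Algebra.algebraMap_eq_smul_one]
    module
  have hYJ : Y * J = ((k : ZMod q) - b) • J := by
    rw [hY, sub_mul, hXJ, ← Algebra.smul_def, sub_smul]
  have hab : (a : ZMod q) - b ≠ 0 := by
    rw [← Int.cast_sub]
    exact fun h => hqab ((ZMod.intCast_zmod_eq_zero_iff_dvd _ _).1 h)
  have hv : (v : ZMod q) ≠ 0 := fun h => hqv ((ZMod.natCast_eq_zero_iff _ _).1 h)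
  obtain ⟨u, hu⟩ := exists_pow_succ_eq_add_smul hYY hYJ (q - 1)
  rw [Nat.sub_add_cancel hq.one_le, ZMod.pow_card_sub_one_eq_one hab, one_smul] at hu
  have hYqJ (i : ℕ) : Y ^ i * J = ((k : ZMod q) - b) ^ i • J := by
    induction i with
    | zero => simp
    | succ i ih => rw [pow_succ, mul_assoc, hYJ, mul_smul_comm, ih, smul_smul, pow_succ, mul_comm]
  have hu0 : u = 0 := by
    have h := hYqJ q
    rw [ZMod.pow_card, hu, add_mul, hYJ, smul_mul_assoc, hJJ, add_eq_left, smul_smul] at h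
    have h' := congrArg (fun z : MonoidAlgebra (ZMod q) G => z.coeff 1) h
    simp only [coeff_smul, Finsupp.smul_apply, hJc, coeff_zero, Finsupp.zero_apply, smul_eq_mul,
      mul_one] at h'
    exact (mul_eq_zero.1 h').resolve_right hv
  have hXq : X ^ q = X := by
    rw [hu0, zero_smul, add_zero, hY, sub_pow_char, ← map_pow, ZMod.pow_card] at hu
    exact sub_left_injective hu
  have hXq' : X ^ q = ∑ x ∈ D, single (x ^ q) 1 := by
    simp only [hX, sum_pow_char, single_pow, one_pow]
  have hcop : (Nat.card G).Coprime q := by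
    rw [Nat.card_eq_fintype_card, hD.1]
    exact ((Nat.Prime.coprime_iff_not_dvd hq).2 hqv).symm
  have hinj : Function.Injective fun x : G => x ^ q := (powCoprime hcop).injective
  have hcard : (D.filter (fun x => x ^ q = d ^ q)) = {d} := by
    ext x
    simp only [Finset.mem_filter, Finset.mem_singleton]
    exact ⟨fun h => hinj h.2, by rintro rfl; exact ⟨hd, rfl⟩⟩
  by_contra hdq
  have h := hXc (d ^ q)
  rw [← hXq, hXq', coeff_sum_single_one, hcard, if_neg hdq] at h
  simp at h

end GroupAlgebra

/-- A set closed under passing to generators of the same cyclic subgroup contains a number of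
elements of order divisible by `p` that is a multiple of `p - 1`. -/
theorem sub_one_dvd_card_filter_dvd_orderOf {G : Type*} [Group G] [DecidableEq G] [Fintype G]
    {D : Finset G} {p : ℕ} (hp : p.Prime)
    (hD : ∀ g ∈ D, ∀ h, Subgroup.zpowers h = Subgroup.zpowers g → h ∈ D) :
    p - 1 ∣ (D.filter (fun g => p ∣ orderOf g)).card := by
  classical
  rw [Finset.card_eq_sum_card_image (fun g => Subgroup.zpowers g)]
  refine Finset.dvd_sum fun H hH => ?_
  obtain ⟨g, hg, rfl⟩ := Finset.mem_image.1 hH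
  rw [Finset.mem_filter] at hg
  have hfib : ((D.filter (fun g => p ∣ orderOf g)).filter
      (fun h => Subgroup.zpowers h = Subgroup.zpowers g)) =
      (Finset.univ.filter (fun h : Subgroup.zpowers g => orderOf h = orderOf g)).map
        (Function.Embedding.subtype _) := by
    ext h
    simp only [Finset.mem_filter, Finset.mem_map, Finset.mem_univ, true_and,
      Function.Embedding.subtype_apply, Subtype.exists, Subgroup.orderOf_mk, exists_and_left,
      exists_prop, exists_eq_right_right]
    constructor
    · rintro ⟨_, h2⟩
      exact ⟨by rw [← Nat.card_zpowers, h2, Nat.card_zpowers], h2 ▸ Subgroup.mem_zpowers h⟩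
    · rintro ⟨h1, h2⟩
      have h3 : Subgroup.zpowers h = Subgroup.zpowers g := by
        apply Subgroup.eq_of_le_of_card_ge (by simpa using h2)
        rw [Nat.card_zpowers, Nat.card_zpowers, h1]
      exact ⟨⟨hD g hg.1 h h3, h1 ▸ hg.2⟩, h3⟩
  rw [hfib, Finset.card_map, IsCyclic.card_orderOf_eq_totient
    (by rw [← Nat.card_eq_fintype_card, Nat.card_zpowers]), ← Nat.totient_prime hp]
  exact Nat.totient_dvd_of_dvd hg.2

theorem card_filter_not_dvd_orderOf_le {G : Type*} [CommGroup G] [DecidableEq G] [Fintype G]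
    {p : ℕ} (hp : p.Prime) (hp2 : p ≠ 2) {i j : ℕ} (hG : Fintype.card G = 2 ^ i * p ^ j) :
    (Finset.univ.filter (fun g : G => ¬ p ∣ orderOf g)).card ≤ 2 ^ i := by
  classical
  have : Fact (Nat.Prime 2) := ⟨Nat.prime_two⟩
  let K : Subgroup G := (powMonoidHom (2 ^ i)).ker
  have hK : IsPGroup 2 K := fun g => ⟨i, Subtype.ext (MonoidHom.mem_ker.1 g.2)⟩
  obtain ⟨n, hn⟩ := IsPGroup.iff_card.1 hK
  have hcop : (2 ^ n).Coprime (p ^ j) :=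
    ((Nat.coprime_primes Nat.prime_two hp).2 hp2.symm).pow _ _
  have hdvd : 2 ^ n ∣ 2 ^ i := by
    refine hcop.dvd_of_dvd_mul_right ?_
    rw [← hn, ← hG, ← Nat.card_eq_fintype_card]
    exact K.card_subgroup_dvd_card
  calc (Finset.univ.filter (fun g : G => ¬ p ∣ orderOf g)).card
      ≤ (K : Set G).toFinset.card := by
        refine Finset.card_le_card fun g hg => ?_
        rw [Finset.mem_filter] at hg
        have : orderOf g ∣ 2 ^ i := by
          refine Nat.Coprime.dvd_of_dvd_mul_right
            (((Nat.Prime.coprime_iff_not_dvd hp).2 hg.2).symm.pow_right j) ?_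
          rw [← hG]
          exact orderOf_dvd_card
        rw [Set.mem_toFinset]
        exact orderOf_dvd_iff_pow_eq_one.1 this
    _ = 2 ^ n := by rw [← hn, Set.toFinset_card, ← Nat.card_eq_fintype_card]; rfl
    _ ≤ 2 ^ i := Nat.le_of_dvd (by positivity) hdvd

/-- Two generators of the same finite cyclic subgroup are related by an arbitrarily large prime
exponent. -/
theorem exists_prime_gt_pow_eq_of_zpowers_eq {G : Type*} [Group G] [Finite G] {g h : G}
    (hgh : Subgroup.zpowers h = Subgroup.zpowers g) (N : ℕ) :
    ∃ q : ℕ, N < q ∧ q.Prime ∧ g ^ q = h := by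
  have hmem : h ∈ Submonoid.powers g := by
    rw [mem_powers_iff_mem_zpowers, ← hgh]
    exact Subgroup.mem_zpowers h
  obtain ⟨t, rfl⟩ := hmem
  have hcop : t.Coprime (orderOf g) :=
    mem_zpowers_pow_iff.1 (hgh ▸ Subgroup.mem_zpowers g)
  obtain ⟨q, hq, hqp, hqt⟩ := Nat.forall_exists_prime_gt_and_modEq N (orderOf_pos g).ne' hcop
  exact ⟨q, hq, hqp, pow_eq_pow_iff_modEq.2 hqt⟩

/-- For `p = 4y^2+5y+2 ≥ 5` prime, there is no nontrivial regular
`(8p^3, 4p^2-2p+4y+2, 2p+8y+2, 2p-2)`-PDS in an Abelian group. -/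
theorem no_pds_case4ii (y p : ℕ) (hpy : p = 4 * y ^ 2 + 5 * y + 2)
    (hp : p.Prime) (hp5 : 5 ≤ p)
    {G : Type*} [CommGroup G] [DecidableEq G] [Fintype G]
    (D : Finset G) :
    ¬ (IsPDS D (8 * p ^ 3) (4 * p ^ 2 - 2 * p + 4 * y + 2) (2 * p + 8 * y + 2)
          (2 * p - 2) ∧
        IsRegularPDS D ∧ ¬ IsTrivialPDS D) := by
  rintro ⟨hD, hr, -⟩
  have hk : 2 * p ≤ 4 * p ^ 2 := by nlinarith
  have hm : 2 ≤ 2 * p := by lia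
  have hpZ : (p : ℤ) = 4 * y ^ 2 + 5 * y + 2 := by exact_mod_cast hpy
  have hclosed : ∀ g ∈ D, ∀ h, Subgroup.zpowers h = Subgroup.zpowers g → h ∈ D := by
    intro g hg h hgh
    obtain ⟨q, hqN, hq, rfl⟩ := exists_prime_gt_pow_eq_of_zpowers_eq hgh (8 * p ^ 3)
    have hpp : p ≤ p ^ 3 := Nat.le_self_pow (by norm_num) p
    refine pow_prime_mem_of_isPDS hD hr (a := 4 * y + 2 + 2 * p) (b := 4 * y + 2 - 2 * p)
      ?_ ?_ hq (Nat.not_dvd_of_pos_of_lt (by positivity) hqN) ?_ hg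
    · push_cast [Nat.cast_sub hm]
      ring
    · push_cast [Nat.cast_sub hm, Nat.cast_sub hk]
      linear_combination (-4 : ℤ) * hpZ
    · rw [show (4 * y + 2 + 2 * p - (4 * y + 2 - 2 * p) : ℤ) = ((4 * p : ℕ) : ℤ) by
        push_cast; ring, Int.natCast_dvd_natCast]
      exact Nat.not_dvd_of_pos_of_lt (by lia) (by lia)
  obtain ⟨c, hc⟩ := sub_one_dvd_card_filter_dvd_orderOf hp hclosed
  have hsmall : (D.filter (fun g => ¬ p ∣ orderOf g)).card < 8 := by
    refine (Finset.card_lt_card ?_).trans_le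
      (card_filter_not_dvd_orderOf_le hp (by lia) (i := 3) (j := 3) hD.1)
    rw [Finset.ssubset_iff_of_subset (Finset.filter_subset_filter _ (Finset.subset_univ D))]
    exact ⟨1, by simpa using hp.one_lt.ne', by simp [hr.2]⟩
  have hsplit := Finset.card_filter_add_card_filter_not (s := D) (fun g => p ∣ orderOf g)
  rw [hD.2.1, hc] at hsplit
  set s := (D.filter (fun g => ¬ p ∣ orderOf g)).card
  have hy : 1 ≤ y := by
    by_contra h
    obtain rfl : y = 0 := by lia
    lia
  have hdvd : (p : ℤ) - 1 ∣ 4 * y + 4 - s := by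
    refine ⟨c - (4 * p + 2), ?_⟩
    have h : ((p : ℤ) - 1) * c + s = 4 * p ^ 2 - 2 * p + 4 * y + 2 := by
      have := congrArg (Nat.cast : ℕ → ℤ) hsplit
      push_cast [Nat.cast_sub hk, Nat.cast_sub hp.one_le] at this
      exact this
    linear_combination -h
  have hyZ : (1 : ℤ) ≤ y := by exact_mod_cast hy
  have hsZ : (s : ℤ) < 8 := by exact_mod_cast hsmall
  have hle := Int.le_of_dvd (by lia) hdvd
  nlinarith
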